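/- Let G be a finite simple graph with vertex set V and e edges, and let k ≥ 3 be an odd integer such that every vertex of G has degree at least k−1. Define a 2-CNF multiset φ over variables V as follows: for each vertex x, the clause A_x = (¬x) with multiplicity deg(x) − (k−1)/2; for each vertex x and each neighbor y of x, the clause (x ∨ ¬y) with multiplicity 1; and for each pair {x,y} of distinct non-adjacent vertices, the clause (x ∨ y) with multiplicity 4e. Let σ be the total assignment with σ(x) = 1 for all x ∈ V. If μ is a partial assignment with μ(x) ∈ {1,⊥} for all x, μ ≠ σ, and E(φ, μ) ≥ E(φ, σ), then the set K = {x ∈ V : μ(x) = ⊥} is a clique in G of size at least k. -/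

import Mathlib

/-- The set of completions of a partial assignment `μ`. -/
def Comp {α : Type} [Fintype α] [DecidableEq α] (μ : α → Option Bool) :
    Finset (α → Bool) :=
  Finset.univ.filter (fun z => ∀ i, ∀ b : Bool, μ i = some b → z i = b)

/-- The number of variables undefined in a partial assignment. -/
def numUndef {α : Type} [Fintype α] [DecidableEq α] (μ : α → Option Bool) : ℕ :=
  (Finset.univ.filter (fun i => μ i = none)).card

/-- A total assignment `z` satisfies a clause, represented as a list of
literals `(i, b)` (where `b = true` is the positive literal `x_i` and
`b = false` is the negative literal `¬x_i`). -/
def SatClause {α : Type} (C : List (α × Bool)) (z : α → Bool) : Prop :=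
  ∃ l ∈ C, z l.1 = l.2

instance {α : Type} (C : List (α × Bool)) (z : α → Bool) :
    Decidable (SatClause C z) := by
  unfold SatClause; infer_instance

/-- The number of completions of `μ` satisfying the clause `C`. -/
def satCount {α : Type} [Fintype α] [DecidableEq α]
    (C : List (α × Bool)) (μ : α → Option Bool) : ℕ :=
  ((Comp μ).filter (fun z => SatClause C z)).card

/-- `E(φ, μ)`: the expected number of clauses of the CNF multiset `φ`
satisfied by a uniformly random completion of the partial assignment `μ`. -/
noncomputable def Eexp {α : Type} [Fintype α] [DecidableEq α]
    (φ : Multiset (List (α × Bool))) (μ : α → Option Bool) : ℝ :=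
  (φ.map (fun C => (satCount C μ : ℝ))).sum / 2 ^ numUndef μ

/-- The 2-CNF multiset of the reduction from `Clique`: for each vertex `x`
the clause `(¬x)` with multiplicity `deg(x) − (k−1)/2`; for each vertex `x`
and each neighbor `y` of `x` the clause `(x ∨ ¬y)`; and for each pair of
distinct non-adjacent vertices `{x, y}` the clause `(x ∨ y)` with
multiplicity `4e`, where `e` is the number of edges. -/
def phiG {V : Type} [Fintype V] [DecidableEq V] [LinearOrder V]
    (G : SimpleGraph V) [DecidableRel G.Adj] (k : ℕ) :
    Multiset (List (V × Bool)) :=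
  (Finset.univ.val.bind fun x : V =>
      Multiset.replicate (G.degree x - (k - 1) / 2) [(x, false)])
  + (Finset.univ.val.bind fun x : V =>
      (G.neighborFinset x).val.map fun y => [(x, true), (y, false)])
  + (Finset.univ.val.bind fun x : V =>
      Finset.univ.val.bind fun y : V =>
        if x < y ∧ ¬ G.Adj x y then
          Multiset.replicate (4 * G.edgeFinset.card) [(x, true), (y, true)]
        else 0)

open Finset in
theorem card_Comp {α : Type} [Fintype α] [DecidableEq α] (μ : α → Option Bool) :
    (Comp μ).card = 2 ^ numUndef μ := by
  have h : Comp μ =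
      Fintype.piFinset (fun i => (univ : Finset Bool).filter fun c => ∀ b, μ i = some b → c = b) := by
    ext z
    simp [Comp]
  rw [h, Fintype.card_piFinset, numUndef, card_filter, ← prod_pow_eq_pow_sum]
  refine prod_congr rfl fun i _ => ?_
  rcases hi : μ i with _ | b
  · simp
  · cases b <;> simp <;> rfl

theorem numUndef_update {α : Type} [Fintype α] [DecidableEq α] (μ : α → Option Bool) (x : α)
    (a : Bool) (hx : μ x = none) :
    numUndef μ = numUndef (Function.update μ x (some a)) + 1 := by
  have h : Finset.univ.filter (fun i => Function.update μ x (some a) i = none) =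
      (Finset.univ.filter fun i => μ i = none).erase x := by
    ext i
    by_cases hi : i = x <;> simp [hi, Function.update_apply]
  rw [numUndef, numUndef, h, Finset.card_erase_add_one (by simpa using hx)]

theorem mem_Comp_update {α : Type} [Fintype α] [DecidableEq α] (μ : α → Option Bool) (x : α)
    (a : Bool) (hx : μ x = none) (z : α → Bool) :
    z ∈ Comp (Function.update μ x (some a)) ↔ z ∈ Comp μ ∧ z x = a := by
  simp only [Comp, Finset.mem_filter, Finset.mem_univ, true_and]
  constructor
  · refine fun h => ⟨fun i b hi => ?_, h x a (by simp)⟩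
    have hix : i ≠ x := by
      rintro rfl
      simp [hx] at hi
    exact h i b (by simpa [hix] using hi)
  · rintro ⟨h, rfl⟩ i b hi
    by_cases hix : i = x
    · subst hix
      simpa using hi
    · exact h i b (by simpa [hix] using hi)

/-- The probability that a uniformly random completion of `μ` satisfies `C`. -/
noncomputable def satProb {α : Type} [Fintype α] [DecidableEq α]
    (μ : α → Option Bool) (C : List (α × Bool)) : ℝ :=
  (satCount C μ : ℝ) / 2 ^ numUndef μ

theorem Eexp_eq_sum_satProb {α : Type} [Fintype α] [DecidableEq α]
    (φ : Multiset (List (α × Bool))) (μ : α → Option Bool) :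
    Eexp φ μ = (φ.map (satProb μ)).sum := by
  change _ = (φ.map fun C => (satCount C μ : ℝ) / 2 ^ numUndef μ).sum
  rw [Multiset.sum_map_div, Eexp]

theorem satProb_eq_one {α : Type} [Fintype α] [DecidableEq α] (μ : α → Option Bool)
    (C : List (α × Bool)) (h : ∀ z ∈ Comp μ, SatClause C z) : satProb μ C = 1 := by
  rw [satProb, satCount, Finset.filter_true_of_mem h, card_Comp]
  simp

theorem satProb_eq_zero {α : Type} [Fintype α] [DecidableEq α] (μ : α → Option Bool)
    (C : List (α × Bool)) (h : ∀ z ∈ Comp μ, ¬ SatClause C z) : satProb μ C = 0 := by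
  rw [satProb, satCount, Finset.filter_false_of_mem h]
  simp

theorem satProb_eq_half {α : Type} [Fintype α] [DecidableEq α] (μ : α → Option Bool)
    (C : List (α × Bool)) (x : α) (a : Bool) (hx : μ x = none)
    (h : ∀ z ∈ Comp μ, SatClause C z ↔ z x = a) : satProb μ C = 1 / 2 := by
  have he : (Comp μ).filter (fun z => SatClause C z) = Comp (Function.update μ x (some a)) := by
    ext z
    rw [mem_Comp_update μ x a hx, Finset.mem_filter]
    exact and_congr_right (h z)
  rw [satProb, satCount, he, card_Comp, numUndef_update μ x a hx]
  push_cast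
  rw [pow_succ]
  field_simp

theorem satProb_eq_three_quarters {α : Type} [Fintype α] [DecidableEq α] (μ : α → Option Bool)
    (x y : α) (a b : Bool) (hxy : x ≠ y) (hx : μ x = none) (hy : μ y = none) :
    satProb μ [(x, a), (y, b)] = 3 / 4 := by
  have hy' : Function.update μ x (some !a) y = none := by simpa [hxy.symm] using hy
  have he : (Comp μ).filter (fun z => ¬ SatClause [(x, a), (y, b)] z) =
      Comp (Function.update (Function.update μ x (some !a)) y (some !b)) := by
    ext z
    rw [mem_Comp_update _ y _ hy', mem_Comp_update μ x _ hx, Finset.mem_filter]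
    simp [SatClause, and_assoc, Bool.eq_not]
  have hc := (Comp μ).card_filter_add_card_filter_not
    (fun z => SatClause [(x, a), (y, b)] z)
  rw [he, card_Comp, card_Comp, numUndef_update μ x (!a) hx, numUndef_update _ y (!b) hy'] at hc
  rw [satProb, satCount, numUndef_update μ x (!a) hx, numUndef_update _ y (!b) hy']
  rw [div_eq_iff (by positivity)]
  have hc' := congrArg (Nat.cast (R := ℝ)) hc
  push_cast at hc'
  rw [pow_succ, pow_succ] at hc' ⊢
  linarith

/-- The real-valued indicator of being undefined in `μ`. -/
def undefInd {α : Type} (μ : α → Option Bool) (x : α) : ℝ :=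
  if μ x = none then 1 else 0

theorem undefInd_nonneg {α : Type} (μ : α → Option Bool) (x : α) : 0 ≤ undefInd μ x := by
  unfold undefInd
  split_ifs <;> norm_num

theorem undefInd_le_one {α : Type} (μ : α → Option Bool) (x : α) : undefInd μ x ≤ 1 := by
  unfold undefInd
  split_ifs <;> norm_num

theorem sum_undefInd {α : Type} [Fintype α] [DecidableEq α] (μ : α → Option Bool) :
    ∑ x, undefInd μ x = ((Finset.univ.filter fun x => μ x = none).card : ℝ) := by
  simp [undefInd]

theorem apply_of_mem_Comp {α : Type} [Fintype α] [DecidableEq α] {μ : α → Option Bool}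
    {z : α → Bool} (hz : z ∈ Comp μ) {x : α} {b : Bool} (hx : μ x = some b) : z x = b :=
  (Finset.mem_filter.1 hz).2 x b hx

theorem satProb_neg {α : Type} [Fintype α] [DecidableEq α] (μ : α → Option Bool)
    (hμ : ∀ x, μ x = some true ∨ μ x = none) (x : α) :
    satProb μ [(x, false)] = undefInd μ x / 2 := by
  rcases hμ x with hx | hx
  · rw [satProb_eq_zero]
    · simp [undefInd, hx]
    · intro z hz
      simp [SatClause, apply_of_mem_Comp hz hx]
  · rw [satProb_eq_half μ _ x false hx]
    · simp [undefInd, hx]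
    · simp [SatClause]

theorem satProb_pos_neg {α : Type} [Fintype α] [DecidableEq α] (μ : α → Option Bool)
    (hμ : ∀ x, μ x = some true ∨ μ x = none) (x y : α) (hxy : x ≠ y) :
    satProb μ [(x, true), (y, false)] =
      1 - undefInd μ x / 2 + undefInd μ x * undefInd μ y / 4 := by
  rcases hμ x with hx | hx
  · rw [satProb_eq_one]
    · simp [undefInd, hx]
    · intro z hz
      simp [SatClause, apply_of_mem_Comp hz hx]
  · rcases hμ y with hy | hy
    · rw [satProb_eq_half μ _ x true hx]
      · have hy' : μ y ≠ none := by simp [hy]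
        norm_num [undefInd, hx, hy']
      · intro z hz
        simp [SatClause, apply_of_mem_Comp hz hy]
    · rw [satProb_eq_three_quarters μ x y _ _ hxy hx hy]
      norm_num [undefInd, hx, hy]

theorem satProb_pos_pos {α : Type} [Fintype α] [DecidableEq α] (μ : α → Option Bool)
    (hμ : ∀ x, μ x = some true ∨ μ x = none) (x y : α) (hxy : x ≠ y) :
    satProb μ [(x, true), (y, true)] = 1 - undefInd μ x * undefInd μ y / 4 := by
  rcases hμ x with hx | hx
  · rw [satProb_eq_one]
    · simp [undefInd, hx]
    · intro z hz
      simp [SatClause, apply_of_mem_Comp hz hx]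
  · rcases hμ y with hy | hy
    · rw [satProb_eq_one]
      · simp [undefInd, hy]
      · intro z hz
        simp [SatClause, apply_of_mem_Comp hz hy]
    · rw [satProb_eq_three_quarters μ x y _ _ hxy hx hy]
      norm_num [undefInd, hx, hy]

theorem Eexp_phiG {V : Type} [Fintype V] [DecidableEq V] [LinearOrder V]
    (G : SimpleGraph V) [DecidableRel G.Adj] (k : ℕ) (hodd : Odd k)
    (hdeg : ∀ x : V, k - 1 ≤ G.degree x) (μ : V → Option Bool)
    (hμ : ∀ x, μ x = some true ∨ μ x = none) :
    Eexp (phiG G k) μ = (∑ x, (G.degree x : ℝ) -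
        ((k : ℝ) - 1) / 4 * ∑ x, undefInd μ x +
        (∑ x, ∑ y ∈ G.neighborFinset x, undefInd μ x * undefInd μ y) / 4) +
      ∑ x, ∑ y, if x < y ∧ ¬ G.Adj x y then
        4 * (G.edgeFinset.card : ℝ) * (1 - undefInd μ x * undefInd μ y / 4) else 0 := by
  rw [Eexp_eq_sum_satProb, phiG]
  simp only [Multiset.map_add, Multiset.sum_add, Multiset.map_bind, Multiset.sum_bind,
    Multiset.map_replicate, Multiset.sum_replicate, Multiset.map_map, Function.comp_def]
  congr 1
  · have h1 : ∀ x : V, (G.degree x - (k - 1) / 2) • satProb μ [(x, false)] =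
        ((G.degree x : ℝ) - ((k : ℝ) - 1) / 2) * (undefInd μ x / 2) := by
      intro x
      obtain ⟨m, rfl⟩ := hodd
      have hx := hdeg x
      rw [satProb_neg μ hμ, nsmul_eq_mul, Nat.cast_sub (by omega),
        show (2 * m + 1 - 1) / 2 = m by omega]
      push_cast
      ring
    have h2 : ∀ x : V, ((G.neighborFinset x).val.map
          fun y => satProb μ [(x, true), (y, false)]).sum =
        (G.degree x : ℝ) * (1 - undefInd μ x / 2) +
          (∑ y ∈ G.neighborFinset x, undefInd μ x * undefInd μ y) / 4 := by
      intro x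
      change ∑ y ∈ G.neighborFinset x, satProb μ [(x, true), (y, false)] = _
      rw [Finset.sum_congr rfl fun y hy => satProb_pos_neg μ hμ x y
        (((G.mem_neighborFinset x y).1 hy).ne), Finset.sum_add_distrib, Finset.sum_const,
        G.card_neighborFinset_eq_degree, nsmul_eq_mul, Finset.sum_div]
    simp only [h1, h2]
    change ∑ x, _ + ∑ x, _ = _
    rw [Finset.mul_sum, Finset.sum_div, ← Finset.sum_add_distrib, ← Finset.sum_sub_distrib,
      ← Finset.sum_add_distrib]
    exact Finset.sum_congr rfl fun x _ => by ring
  · change ∑ x, ∑ y, _ = _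
    refine Finset.sum_congr rfl fun x _ => Finset.sum_congr rfl fun y _ => ?_
    split_ifs with h
    · rw [Multiset.map_replicate, Multiset.sum_replicate, satProb_pos_pos μ hμ x y h.1.ne,
        nsmul_eq_mul]
      push_cast
      ring
    · simp

/-- Conversely: if a partial assignment `μ ⊆ σ` (each variable is `1` or
undefined) differs from the all-ones assignment `σ` and satisfies
`E(φ, μ) ≥ E(φ, σ)`, then the set of undefined variables of `μ` is a clique
of size at least `k` in `G`. -/
theorem stmt11 {V : Type} [Fintype V] [DecidableEq V] [LinearOrder V]
    (G : SimpleGraph V) [DecidableRel G.Adj]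
    (k : ℕ) (hk : 3 ≤ k) (hodd : Odd k)
    (hdeg : ∀ x : V, k - 1 ≤ G.degree x)
    (μ : V → Option Bool)
    (hμ : ∀ x, μ x = some true ∨ μ x = none)
    (hne : μ ≠ fun _ => some true)
    (hE : Eexp (phiG G k) (fun _ => some true) ≤ Eexp (phiG G k) μ) :
    G.IsClique {x : V | μ x = none} ∧
      k ≤ (Finset.univ.filter (fun x : V => μ x = none)).card := by
  set u := undefInd μ with hu
  set K := Finset.univ.filter (fun x : V => μ x = none) with hK
  set D := ∑ x, ∑ y ∈ G.neighborFinset x, u x * u y with hD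
  set M := ∑ x, ∑ y, (if x < y ∧ ¬ G.Adj x y then u x * u y else 0) with hM
  have u0 : ∀ x, 0 ≤ u x := undefInd_nonneg μ
  have u1 : ∀ x, u x ≤ 1 := undefInd_le_one μ
  have hn : ∑ x, u x = (K.card : ℝ) := sum_undefInd μ
  have hgain : 0 ≤ -(((k : ℝ) - 1) / 4 * K.card) + D / 4 - G.edgeFinset.card * M := by
    rw [Eexp_phiG G k hodd hdeg μ hμ, Eexp_phiG G k hodd hdeg _ (fun _ => Or.inl rfl)] at hE
    have hsplit : (∑ x, ∑ y, if x < y ∧ ¬ G.Adj x y then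
          4 * (G.edgeFinset.card : ℝ) * (1 - u x * u y / 4) else 0) =
        (∑ x, ∑ y, if x < y ∧ ¬ G.Adj x y then 4 * (G.edgeFinset.card : ℝ) else 0) -
          G.edgeFinset.card * M := by
      rw [hM, Finset.mul_sum, ← Finset.sum_sub_distrib]
      refine Finset.sum_congr rfl fun x _ => ?_
      rw [Finset.mul_sum, ← Finset.sum_sub_distrib]
      refine Finset.sum_congr rfl fun y _ => ?_
      split_ifs <;> ring
    rw [← hu, hsplit, hn, ← hD] at hE
    simp only [undefInd, reduceCtorEq, if_false, Finset.sum_const_zero, mul_zero, zero_div,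
      sub_zero, mul_one, add_zero] at hE
    linarith
  have hpos : (1 : ℝ) ≤ K.card := by
    obtain ⟨x, hx⟩ := Function.ne_iff.1 hne
    have hxK : x ∈ K := by simpa [hK] using (hμ x).resolve_left hx
    exact_mod_cast Finset.card_pos.2 ⟨x, hxK⟩
  have hterm : ∀ x y, 0 ≤ (if x < y ∧ ¬ G.Adj x y then u x * u y else 0) := fun x y => by
    split_ifs
    · exact mul_nonneg (u0 x) (u0 y)
    · exact le_rfl
  have hk' : (3 : ℝ) ≤ k := by exact_mod_cast hk
  have he0 : (0 : ℝ) ≤ G.edgeFinset.card := Nat.cast_nonneg _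
  constructor
  · by_contra hcl
    have hMge : 1 ≤ M := by
      obtain ⟨x, y, hx, hy, hxy, hadj⟩ :
          ∃ x y, μ x = none ∧ μ y = none ∧ x < y ∧ ¬ G.Adj x y := by
        simp only [SimpleGraph.isClique_iff, Set.Pairwise, Set.mem_ofPred_eq] at hcl
        push Not at hcl
        obtain ⟨x, hx, y, hy, hxy, hadj⟩ := hcl
        rcases lt_or_gt_of_ne hxy with h | h
        · exact ⟨x, y, hx, hy, h, hadj⟩
        · exact ⟨y, x, hy, hx, h, fun h' => hadj h'.symm⟩
      calc (1 : ℝ) = if x < y ∧ ¬ G.Adj x y then u x * u y else 0 := by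
            simp [hxy, hadj, hu, undefInd, hx, hy]
        _ ≤ ∑ y, if x < y ∧ ¬ G.Adj x y then u x * u y else 0 :=
            Finset.single_le_sum (f := fun y => if x < y ∧ ¬ G.Adj x y then u x * u y else 0)
              (fun y _ => hterm x y) (Finset.mem_univ y)
        _ ≤ M :=
            Finset.single_le_sum
              (f := fun x => ∑ y, if x < y ∧ ¬ G.Adj x y then u x * u y else 0)
              (fun x _ => Finset.sum_nonneg fun y _ => hterm x y) (Finset.mem_univ x)
    have hDle : D ≤ 2 * G.edgeFinset.card := by
      calc D ≤ ∑ x, (G.degree x : ℝ) := by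
            refine Finset.sum_le_sum fun x _ => ?_
            calc ∑ y ∈ G.neighborFinset x, u x * u y ≤ ∑ y ∈ G.neighborFinset x, (1 : ℝ) :=
                  Finset.sum_le_sum fun y _ => mul_le_one₀ (u1 x) (u0 y) (u1 y)
              _ = G.degree x := by simp
        _ = 2 * G.edgeFinset.card := by exact_mod_cast G.sum_degrees_eq_twice_card_edges
    nlinarith [mul_le_mul_of_nonneg_left hMge he0,
      mul_pos (show (0 : ℝ) < k - 1 by linarith) (show (0 : ℝ) < K.card by linarith)]
  · have hM0 : 0 ≤ M := Finset.sum_nonneg fun x _ => Finset.sum_nonneg fun y _ => hterm x y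
    have hDle : D ≤ K.card * (K.card - 1) := by
      calc D ≤ ∑ x, u x * ((K.card : ℝ) - 1) := by
            refine Finset.sum_le_sum fun x _ => ?_
            have hle : ∑ y ∈ G.neighborFinset x, u y ≤ K.card - u x := by
              rw [← hn, ← Finset.add_sum_erase _ u (Finset.mem_univ x), add_sub_cancel_left]
              refine Finset.sum_le_sum_of_subset_of_nonneg (fun y hy => ?_) fun y _ _ => u0 y
              simpa using ((G.mem_neighborFinset x y).1 hy).ne'
            have hidem : u x * u x = u x := by
              simp [hu, undefInd]
            rw [← Finset.mul_sum]
            nlinarith [mul_le_mul_of_nonneg_left hle (u0 x)]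
        _ = K.card * (K.card - 1) := by rw [← Finset.sum_mul, hn]
    have hfin : 0 ≤ (K.card : ℝ) * (K.card - k) := by
      nlinarith [mul_nonneg he0 hM0]
    have := nonneg_of_mul_nonneg_right hfin (by linarith)
    exact_mod_cast sub_nonneg.1 this
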